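/- Fix a natural number n and let J ⊆ I ⊆ {0,…,n−1}, with I^c = {0,…,n−1}∖I the complement of I. Then σ(J, I∖J) = σ(I^c, I) · σ(I^c, J) · σ(I^c∪J, I∖J). (This is the signature identity of Appendix A.2 proving that the right interior product can be expressed through the exterior product and the Hodge complement: e_I ⌑ e_J = (e_I^{H⁻¹} ∧ e_J)^{H}.) -/

import Mathlib

/-- Number of "inversion" pairs (a,b) ∈ A × B with b < a. -/
def invCount (A B : Finset ℕ) : ℕ :=
  ((A ×ˢ B).filter (fun p => p.2 < p.1)).card

/-- The signature σ(A,B) = (−1)^{N(A,B)} of the permutation sorting the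
concatenation of the increasing enumerations of A and B. -/
def sortSign (A B : Finset ℕ) : ℤ :=
  (-1) ^ invCount A B

theorem sortSign_union_left {A B : Finset ℕ} (h : Disjoint A B) (C : Finset ℕ) :
    sortSign (A ∪ B) C = sortSign A C * sortSign B C := by
  unfold sortSign invCount
  rw [Finset.union_product, Finset.filter_union, Finset.card_union_of_disjoint, pow_add]
  exact Finset.disjoint_filter_filter (Finset.disjoint_product.2 (Or.inl h))

theorem sortSign_union_right (A : Finset ℕ) {B C : Finset ℕ} (h : Disjoint B C) :
    sortSign A (B ∪ C) = sortSign A B * sortSign A C := by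
  unfold sortSign invCount
  rw [Finset.product_union, Finset.filter_union, Finset.card_union_of_disjoint, pow_add]
  exact Finset.disjoint_filter_filter (Finset.disjoint_product.2 (Or.inr h))

theorem sortSign_mul_self (A B : Finset ℕ) : sortSign A B * sortSign A B = 1 := by
  rw [sortSign, ← mul_pow, neg_one_mul, neg_neg, one_pow]

theorem right_interior_hodge_signature (n : ℕ) (I J : Finset ℕ)
    (hJI : J ⊆ I) (hI : I ⊆ Finset.range n) :
    sortSign J (I \ J) =
      sortSign (Finset.range n \ I) I * sortSign (Finset.range n \ I) J *
        sortSign ((Finset.range n \ I) ∪ J) (I \ J) := by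
  have hC : sortSign (Finset.range n \ I) I =
      sortSign (Finset.range n \ I) J * sortSign (Finset.range n \ I) (I \ J) := by
    rw [← sortSign_union_right _ Finset.disjoint_sdiff, Finset.union_sdiff_of_subset hJI]
  rw [sortSign_union_left (Finset.sdiff_disjoint.mono_right hJI), hC]
  linear_combination
    -sortSign J (I \ J) * sortSign_mul_self (Finset.range n \ I) (I \ J) -
      sortSign J (I \ J) * sortSign (Finset.range n \ I) (I \ J) ^ 2 *
        sortSign_mul_self (Finset.range n \ I) J
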